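/- Let A be a commutative Noetherian ring with dim A/𝒥(A) = r, where 𝒥(A) is the Jacobson radical of A. Let I and L be ideals of A[T] such that L ⊆ I² and L contains a monic polynomial. Let P′ be a finitely generated projective A[T]-module of rank ≥ r + 1. Then any surjection φ : P′ ⊕ A[T] ↠ I/L can be lifted to a surjection Φ : P′ ⊕ A[T] ↠ I such that Φ(0, 1) is a monic polynomial. -/

import Mathlib

/-- The local rank of a module at every prime, as a constant-rank condition. -/
def HasRank (R M : Type*) [CommRing R] [AddCommGroup M] [Module R M] (n : ℕ) : Prop :=
  ∀ p : PrimeSpectrum R,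
    Module.rank (Localization.AtPrime p.asIdeal) (LocalizedModule p.asIdeal.primeCompl M) = n

/-- Coset prime avoidance for a finite set of pairwise incomparable primes. -/
theorem Ideal.exists_add_notMem_of_incomparable {R : Type*} [CommRing R] (L : Ideal R) (a : R)
    (F : Finset (Ideal R)) (hp : ∀ p ∈ F, p.IsPrime)
    (hF : ∀ p ∈ F, ∀ q ∈ F, q ≤ p → q = p) (hL : ∀ p ∈ F, ¬ L ≤ p) :
    ∃ l ∈ L, ∀ p ∈ F, a + l ∉ p := by
  classical
  induction F using Finset.induction_on with
  | empty => exact ⟨0, L.zero_mem, by simp⟩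
  | insert p F hpF ih =>
    obtain ⟨l, hlL, hl⟩ := ih (fun q hq ↦ hp q (Finset.mem_insert_of_mem hq))
      (fun q hq q' hq' ↦ hF q (Finset.mem_insert_of_mem hq) q' (Finset.mem_insert_of_mem hq'))
      (fun q hq ↦ hL q (Finset.mem_insert_of_mem hq))
    by_cases h : a + l ∈ p
    · have hpp := hp p (Finset.mem_insert_self p F)
      have hnot : ¬ L ⊓ F.inf id ≤ p := by
        rw [hpp.inf_le, hpp.inf_le']
        rintro (h1 | ⟨q, hq, hqp⟩)
        · exact hL p (Finset.mem_insert_self p F) h1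
        · exact hpF (hF p (Finset.mem_insert_self p F) q (Finset.mem_insert_of_mem hq) hqp ▸ hq)
      obtain ⟨y, hy, hyp⟩ := SetLike.not_le_iff_exists.1 hnot
      refine ⟨l + y, L.add_mem hlL hy.1, fun q hq hmem ↦ ?_⟩
      rw [← add_assoc] at hmem
      rcases Finset.mem_insert.1 hq with rfl | hq
      · exact hyp ((Ideal.add_mem_iff_right _ h).1 hmem)
      · have hyq : y ∈ q := (Finset.inf_le hq : F.inf id ≤ id q) hy.2
        exact hl q hq ((Ideal.add_mem_iff_left _ hyq).1 hmem)
    · refine ⟨l, hlL, fun q hq ↦ ?_⟩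
      rcases Finset.mem_insert.1 hq with rfl | hq
      · exact h
      · exact hl q hq

/-- The primes containing `H` but not containing `L`. -/
abbrev PrimesOverOff {R : Type*} [CommRing R] (H L : Ideal R) : Type _ :=
  {p : PrimeSpectrum R // H ≤ p.asIdeal ∧ ¬ L ≤ p.asIdeal}

/-- If chains of primes in `V(H) \ V(L)` have length less than `k`, then `k` elements can be moved
modulo `L` so that they have no common zero in `V(H) \ V(L)`. -/
theorem exists_add_notMem_of_length_lt {R : Type*} [CommRing R] [IsNoetherianRing R]
    (L : Ideal R) (k : ℕ) (H : Ideal R) (hH : ∀ c : LTSeries (PrimesOverOff H L), c.length < k)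
    (a : Fin k → R) :
    ∃ l : Fin k → R, (∀ i, l i ∈ L) ∧
      ∀ p : Ideal R, p.IsPrime → H ≤ p → ¬ L ≤ p → ∃ i, a i + l i ∉ p := by
  classical
  induction k generalizing H with
  | zero =>
    refine ⟨fun i ↦ i.elim0, fun i ↦ i.elim0, fun p hp hHp hLp ↦ ?_⟩
    exact absurd (hH (RelSeries.singleton _ ⟨⟨p, hp⟩, hHp, hLp⟩)) (Nat.not_lt_zero _)
  | succ k ih =>
    have hfin := H.finite_minimalPrimes_of_isNoetherianRing
    obtain ⟨l₀, hl₀L, hl₀⟩ := L.exists_add_notMem_of_incomparable (a 0)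
      (hfin.toFinset.filter fun p ↦ ¬ L ≤ p)
      (fun p hp ↦ (hfin.mem_toFinset.1 (Finset.mem_filter.1 hp).1).1.1)
      (fun p hp q hq hqp ↦ by
        have h1 := hfin.mem_toFinset.1 (Finset.mem_filter.1 hp).1
        have h2 := hfin.mem_toFinset.1 (Finset.mem_filter.1 hq).1
        exact le_antisymm hqp (h1.2 h2.1 hqp))
      (fun p hp ↦ (Finset.mem_filter.1 hp).2)
    have hlen : ∀ c : LTSeries (PrimesOverOff (H ⊔ Ideal.span {a 0 + l₀}) L), c.length < k := by
      intro c
      let f : PrimesOverOff (H ⊔ Ideal.span {a 0 + l₀}) L → PrimesOverOff H L :=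
        fun p ↦ ⟨p.1, le_sup_left.trans p.2.1, p.2.2⟩
      have hf : StrictMono f := fun p q h ↦ h
      obtain ⟨q, hq, hqp⟩ := Ideal.exists_minimalPrimes_le (le_sup_left.trans c.head.2.1)
      have hqL : ¬ L ≤ q := fun h ↦ c.head.2.2 (h.trans hqp)
      have hmem : a 0 + l₀ ∈ c.head.1.asIdeal :=
        c.head.2.1 (le_sup_right (a := H) (Ideal.mem_span_singleton_self _))
      have hnot : a 0 + l₀ ∉ q :=
        hl₀ q (Finset.mem_filter.2 ⟨hfin.mem_toFinset.2 hq, hqL⟩)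
      let q' : PrimesOverOff H L := ⟨⟨q, hq.1.1⟩, hq.1.2, hqL⟩
      have hlt : q' < (c.map f hf).head := by
        change q < c.head.1.asIdeal
        exact lt_of_le_of_ne hqp fun h ↦ hnot (h ▸ hmem)
      have := hH ((c.map f hf).cons q' hlt)
      simpa using this
    obtain ⟨l, hlL, hl⟩ := ih _ hlen (fun i ↦ a i.succ)
    refine ⟨Fin.cons l₀ l, Fin.cases hl₀L hlL, fun p hp hHp hLp ↦ ?_⟩
    by_cases h : a 0 + l₀ ∈ p
    · obtain ⟨i, hi⟩ := hl p hp (sup_le hHp ((Ideal.span_singleton_le_iff_mem _).2 h)) hLp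
      exact ⟨i.succ, by simpa using hi⟩
    · exact ⟨0, by simpa using h⟩

/-- A projective module of rank `n` at `p` has, up to an element outside `p`, dual bases of
size `n`. -/
theorem HasRank.exists_dual_family {R M : Type*} [CommRing R] [AddCommGroup M] [Module R M]
    [Module.Finite R M] [Module.Projective R M] {n : ℕ} (h : HasRank R M n)
    (p : Ideal R) [hp : p.IsPrime] :
    ∃ s ∉ p, ∃ (x : Fin n → M) (e : Fin n → M →ₗ[R] R),
      ∀ i j, e i (x j) = if i = j then s else 0 := by
  classical
  let S := p.primeCompl
  let Rp := Localization.AtPrime p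
  let Mp := LocalizedModule S M
  have : Module.FinitePresentation R M := Module.finitePresentation_of_projective R M
  have : Module.Projective Rp Mp :=
    Module.projective_of_isLocalizedModule S (LocalizedModule.mkLinearMap S M)
  have : Module.Free Rp Mp := Module.free_of_flat_of_isLocalRing
  let b : Module.Basis (Fin n) Rp Mp :=
    Module.finBasisOfFinrankEq Rp Mp (Module.finrank_eq_of_rank_eq (h ⟨p, hp⟩))
  have hx : ∀ j, ∃ y : M × S, y.2 • b j = LocalizedModule.mkLinearMap S M y.1 :=
    fun j ↦ IsLocalizedModule.surj S (LocalizedModule.mkLinearMap S M) (b j)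
  choose y hy using hx
  have he : ∀ i, ∃ (e : M →ₗ[R] R) (t : S), Algebra.linearMap R Rp ∘ₗ e =
      t • ((b.coord i).restrictScalars R ∘ₗ LocalizedModule.mkLinearMap S M) :=
    fun i ↦ Module.FinitePresentation.exists_lift_of_isLocalizedModule S _ _
  choose e t het using he
  let D : Matrix (Fin n) (Fin n) R := Matrix.of fun i j ↦ e i (y j).1
  have hD : D.map (algebraMap R Rp) =
      Matrix.diagonal fun i ↦ algebraMap R Rp ((t i : R) * (y i).2) := by
    ext i j
    have h1 := LinearMap.congr_fun (het i) (y j).1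
    simp only [LinearMap.comp_apply, Algebra.linearMap_apply, LinearMap.smul_apply,
      LinearMap.restrictScalars_apply] at h1
    rw [← hy j] at h1
    rw [Matrix.map_apply, Matrix.diagonal_apply]
    simp only [D, Matrix.of_apply]
    rw [h1]
    simp only [Submonoid.smul_def, Module.Basis.coord_apply]
    rw [← algebraMap_smul Rp ((y j).2 : R) (b j), map_smul]
    simp only [Module.Basis.repr_self, Finsupp.smul_apply, Finsupp.single_apply, eq_comm (a := j)]
    split_ifs with hij
    · subst hij; simp [Algebra.smul_def]
    · simp
  have hdet : D.det ∉ p := by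
    intro hmem
    have h1 : algebraMap R Rp D.det = algebraMap R Rp (∏ i, ((t i : R) * (y i).2)) := by
      rw [RingHom.map_det, RingHom.mapMatrix_apply, hD, Matrix.det_diagonal, map_prod]
    have h2 : IsUnit (algebraMap R Rp D.det) := by
      rw [h1]
      exact IsLocalization.map_units Rp (⟨∏ i, ((t i : R) * (y i).2),
        S.prod_mem fun i _ ↦ S.mul_mem (t i).2 (y i).2.2⟩ : S)
    exact (IsLocalization.AtPrime.isUnit_to_map_iff Rp p _).1 h2 hmem
  refine ⟨D.det, hdet, fun j ↦ (y j).1, fun i ↦ ∑ k, D.adjugate i k • e k, fun i j ↦ ?_⟩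
  have h3 := congrFun (congrFun D.adjugate_mul i) j
  rw [Matrix.mul_apply, Matrix.smul_apply, Matrix.one_apply] at h3
  simpa [D] using h3

/-- Eisenbud–Evans type general position: a linear form on a projective module whose rank exceeds
the lengths of chains of primes in `V(H) \ V(L)` can be moved modulo `L` so as to be unimodular at
every prime of `V(H) \ V(L)`. -/
theorem HasRank.exists_add_range_not_le {R M : Type*} [CommRing R] [IsNoetherianRing R]
    [AddCommGroup M] [Module R M] [Module.Finite R M] [Module.Projective R M] {n : ℕ}
    (h : HasRank R M n) (H L : Ideal R) (hH : ∀ c : LTSeries (PrimesOverOff H L), c.length < n)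
    (θ : M →ₗ[R] R) :
    ∃ μ : M →ₗ[R] R, (∀ x, μ x ∈ L) ∧
      ∀ p : Ideal R, p.IsPrime → H ≤ p → ¬ L ≤ p → ∃ x, θ x + μ x ∉ p := by
  suffices key : ∀ K : Ideal R, ∃ μ : M →ₗ[R] R, (∀ x, μ x ∈ L) ∧
      ∀ p : Ideal R, p.IsPrime → H ≤ p → ¬ L ≤ p → K ≤ p → ∃ x, θ x + μ x ∉ p by
    obtain ⟨μ, h1, h2⟩ := key ⊥
    exact ⟨μ, h1, fun p hp hHp hLp ↦ h2 p hp hHp hLp bot_le⟩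
  intro K
  induction K using WellFoundedGT.induction with
  | ind K ih =>
    by_cases hK : K = ⊤
    · refine ⟨0, by simp, fun p hp _ _ hKp ↦ ?_⟩
      exact absurd (top_le_iff.1 (hK ▸ hKp)) hp.ne_top
    · obtain ⟨m, hm, hKm⟩ := K.exists_le_maximal hK
      obtain ⟨s, hs, x, e, hex⟩ := h.exists_dual_family m
      have hlt : K < K ⊔ Ideal.span {s} :=
        lt_of_le_of_ne le_sup_left fun heq ↦ hs (hKm (heq ▸
          (le_sup_right (a := K) (Ideal.mem_span_singleton_self s))))
      obtain ⟨μ, hμL, hμ⟩ := ih _ hlt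
      have hlen : ∀ c : LTSeries (PrimesOverOff H (Ideal.span {s * s} * L)), c.length < n :=
        fun c ↦ hH (c.map (fun p ↦ ⟨p.1, p.2.1, fun hL ↦ p.2.2 (Ideal.mul_le_right.trans hL)⟩)
          fun p q hpq ↦ hpq)
      obtain ⟨l, hlL, hl⟩ := exists_add_notMem_of_length_lt _ n H hlen
        (fun j ↦ θ (x j) + μ (x j))
      have hl' : ∀ i, ∃ z ∈ L, s * s * z = l i :=
        fun i ↦ Ideal.mem_span_singleton_mul.1 (hlL i)
      choose z hzL hz using hl'
      refine ⟨μ + ∑ i, (s * z i) • e i, fun v ↦ ?_, fun p hp hHp hLp hKp ↦ ?_⟩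
      · simp only [LinearMap.add_apply, LinearMap.sum_apply, LinearMap.smul_apply, smul_eq_mul]
        exact L.add_mem (hμL v) (L.sum_mem fun i _ ↦
          L.mul_mem_right _ (L.mul_mem_left _ (hzL i)))
      · by_cases hsp : s ∈ p
        · obtain ⟨v, hv⟩ := hμ p hp hHp hLp
            (sup_le hKp ((Ideal.span_singleton_le_iff_mem _).2 hsp))
          refine ⟨v, fun hmem ↦ hv ?_⟩
          simp only [LinearMap.add_apply, LinearMap.sum_apply, LinearMap.smul_apply,
            smul_eq_mul, ← add_assoc] at hmem
          exact (Ideal.add_mem_iff_left _ (p.sum_mem fun i _ ↦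
            p.mul_mem_right _ (p.mul_mem_right _ hsp))).1 hmem
        · have hnot : ¬ Ideal.span {s * s} * L ≤ p := by
            rw [hp.mul_le, Ideal.span_singleton_le_iff_mem]
            rintro (h1 | h1)
            · exact hsp ((hp.mem_or_mem h1).elim id id)
            · exact hLp h1
          obtain ⟨j, hj⟩ := hl p hp hHp hnot
          refine ⟨x j, fun hmem ↦ hj ?_⟩
          have : l j = ∑ i, s * z i * e i (x j) := by
            simp only [hex, mul_ite, mul_zero, Finset.sum_ite_eq', Finset.mem_univ, if_true]
            rw [← hz j]; ring
          simpa [this, add_assoc] using hmem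

/-- Primes of `A[T]` containing a monic polynomial and `𝔞 A[T]` form chains no longer than those
of `A ⧸ 𝔞`. -/
theorem Polynomial.Monic.length_le_ringKrullDim {A : Type*} [CommRing A] {g : Polynomial A}
    (hg : g.Monic) (𝔞 : Ideal A) (L : Ideal (Polynomial A))
    (c : LTSeries (PrimesOverOff (𝔞.map Polynomial.C ⊔ Ideal.span {g}) L)) :
    (c.length : WithBot ℕ∞) ≤ ringKrullDim (A ⧸ 𝔞) := by
  have hsurj : Function.Surjective (Ideal.Quotient.mk 𝔞) := Ideal.Quotient.mk_surjective
  have hle : ∀ p : PrimesOverOff (𝔞.map Polynomial.C ⊔ Ideal.span {g}) L,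
      𝔞 ≤ p.1.asIdeal.comap Polynomial.C :=
    fun p ↦ Ideal.map_le_iff_le_comap.1 (le_sup_left.trans p.2.1)
  have hker : ∀ p : PrimesOverOff (𝔞.map Polynomial.C ⊔ Ideal.span {g}) L,
      RingHom.ker (Ideal.Quotient.mk 𝔞) ≤ p.1.asIdeal.comap Polynomial.C :=
    fun p ↦ by rw [Ideal.mk_ker]; exact hle p
  let f : PrimesOverOff (𝔞.map Polynomial.C ⊔ Ideal.span {g}) L → PrimeSpectrum (A ⧸ 𝔞) :=
    fun p ↦ ⟨(p.1.asIdeal.comap Polynomial.C).map (Ideal.Quotient.mk 𝔞),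
      Ideal.map_isPrime_of_surjective hsurj (hker p)⟩
  have hcomap : ∀ p, (f p).asIdeal.comap (Ideal.Quotient.mk 𝔞) =
      p.1.asIdeal.comap Polynomial.C := fun p ↦ by
    rw [Ideal.comap_map_of_surjective' _ hsurj, Ideal.mk_ker, sup_eq_left]
    exact hle p
  have hf : StrictMono f := by
    intro p q hpq
    have hlt : p.1.asIdeal < q.1.asIdeal := hpq
    refine lt_of_le_of_ne (Ideal.map_mono (Ideal.comap_mono hlt.le)) fun heq ↦ ?_
    have hcc : p.1.asIdeal.comap Polynomial.C = q.1.asIdeal.comap Polynomial.C := by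
      rw [← hcomap, ← hcomap, heq]
    obtain ⟨y, hyq, hyp⟩ := SetLike.exists_of_lt hlt
    have hint : ((Ideal.Quotient.mk p.1.asIdeal).comp Polynomial.C).IsIntegralElem
        (Ideal.Quotient.mk p.1.asIdeal y) :=
      hg.quotient_isIntegral (p.2.1 (le_sup_right (a := 𝔞.map Polynomial.C)
        (Ideal.mem_span_singleton_self g))) _
    obtain ⟨u, hu, hu0⟩ := hint
    refine (Ideal.comap_lt_comap_of_root_mem_sdiff (f := Polynomial.C) hlt.le ⟨hyq, hyp⟩
      (p := u) ?_ ?_).ne hcc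
    · have : Nontrivial (A ⧸ p.1.asIdeal.comap Polynomial.C) :=
        Ideal.Quotient.nontrivial_iff.2 (Ideal.IsPrime.comap Polynomial.C).ne_top
      exact (hu.map _).ne_zero
    · rwa [← Ideal.Quotient.eq_zero_iff_mem, Polynomial.hom_eval₂]
  exact Order.LTSeries.length_le_krullDim (c.map f hf)

/-- The contraction to `A` of a maximal ideal of `A[T]` containing a monic polynomial is maximal. -/
theorem Polynomial.Monic.isMaximal_comap_C {A : Type*} [CommRing A] {g : Polynomial A}
    (hg : g.Monic) (m : Ideal (Polynomial A)) [m.IsMaximal] (hgm : g ∈ m) :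
    (m.comap Polynomial.C).IsMaximal := by
  have hint : ((Ideal.Quotient.mk m).comp Polynomial.C).IsIntegral := hg.quotient_isIntegral hgm
  let _ : Field (Polynomial A ⧸ m) := Ideal.Quotient.field m
  have hbot : (⊥ : Ideal (Polynomial A ⧸ m)).IsMaximal := Ideal.bot_isMaximal
  have := Ideal.isMaximal_comap_of_isIntegral_of_isMaximal' _ hint ⊥
  rwa [← Ideal.comap_comap, ← RingHom.ker_eq_comap_bot, Ideal.mk_ker] at this

/-- A Nakayama criterion: if `I ≤ Q + L` with `L ≤ I ^ 2` and every maximal ideal containing `Q`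
contains `L`, then `I ≤ Q`. -/
theorem Ideal.le_of_le_sup_of_forall_isMaximal {R : Type*} [CommRing R] [IsNoetherianRing R]
    {I L Q : Ideal R} (hLI : L ≤ I ^ 2) (hQL : I ≤ Q ⊔ L)
    (h : ∀ m : Ideal R, m.IsMaximal → Q ≤ m → L ≤ m) : I ≤ Q := by
  obtain ⟨w, hw1, hw⟩ := Submodule.exists_sub_one_mem_and_smul_le_of_fg_of_le_sup (I := I)
    (N := Q) (N' := I) (P := I) (IsNoetherian.noetherian I) le_rfl
    (hQL.trans (sup_le_sup_left (by simpa [pow_two] using hLI) Q))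
  by_contra hcon
  have hne : Q.colon (I : Set R) ≠ ⊤ := by
    rwa [Ne, Submodule.colon_eq_top_iff_subset]
  obtain ⟨m, hm, hmle⟩ := Ideal.exists_le_maximal _ hne
  have hQm : Q ≤ m := fun q hq ↦ hmle (Submodule.mem_colon.2 fun x _ ↦ Q.mul_mem_right x hq)
  have hIm : I ≤ m := hQL.trans (sup_le hQm (h m hm hQm))
  have hwm : w ∈ m := hmle (Submodule.mem_colon.2 fun x hx ↦
    hw (Submodule.smul_mem_pointwise_smul x w I hx))
  refine hm.ne_top ((Ideal.eq_top_iff_one m).2 ?_)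
  have := m.sub_mem hwm (hIm hw1)
  simpa using this

/-- (Bhatwadekar–Keshari) Let `A` be Noetherian with `dim A/𝒥(A) = r`, `I, L ⊆ A[T]` ideals
with `L ⊆ I²` and `L` containing a monic polynomial, and `P'` a finitely generated projective
`A[T]`-module of rank `≥ r + 1`.  Then any surjection `φ : P' ⊕ A[T] ↠ I/L` (given by a map to
`I` which is surjective modulo `L`) lifts to a surjection `Φ : P' ⊕ A[T] ↠ I` with `Φ(0,1)`
monic. -/
theorem stmt6 (A : Type*) [CommRing A] [IsNoetherianRing A] (r : ℕ)
    (hr : ringKrullDim (A ⧸ (⊥ : Ideal A).jacobson) = r)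
    (I L : Ideal (Polynomial A)) (hLI : L ≤ I ^ 2) (hmonicL : ∃ g ∈ L, g.Monic)
    (P' : Type*) [AddCommGroup P'] [Module (Polynomial A) P']
    [Module.Finite (Polynomial A) P'] [Module.Projective (Polynomial A) P']
    (n : ℕ) (hrank : HasRank (Polynomial A) P' n) (hn : r + 1 ≤ n)
    (φ : (P' × Polynomial A) →ₗ[Polynomial A] Polynomial A)
    (hφI : LinearMap.range φ ≤ I)
    (hφsurj : LinearMap.range φ ⊔ (L : Submodule (Polynomial A) (Polynomial A)) = I) :
    ∃ Φ : (P' × Polynomial A) →ₗ[Polynomial A] Polynomial A,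
      LinearMap.range Φ = I ∧ (∀ x, Φ x - φ x ∈ L) ∧ (Φ (0, 1)).Monic := by
  obtain ⟨f, hfL, hf⟩ := hmonicL
  nontriviality A
  let N := (φ (0, 1)).natDegree + 1
  let g := φ (0, 1) + Polynomial.X ^ N * f
  have hXf : (Polynomial.X ^ N * f).Monic := (Polynomial.monic_X_pow N).mul hf
  have hXfL : Polynomial.X ^ N * f ∈ L := L.mul_mem_left _ hfL
  have hg : g.Monic := by
    refine hXf.add_of_right (Polynomial.degree_lt_degree ?_)
    rw [(Polynomial.monic_X_pow N).natDegree_mul hf, Polynomial.natDegree_X_pow]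
    omega
  let θ := φ ∘ₗ LinearMap.inl (Polynomial A) P' (Polynomial A)
  let H : Ideal (Polynomial A) :=
    (⊥ : Ideal A).jacobson.map Polynomial.C ⊔ Ideal.span {g}
  have hlen : ∀ c : LTSeries (PrimesOverOff H L), c.length < n := fun c ↦ by
    have := hg.length_le_ringKrullDim _ L c
    rw [hr] at this
    have : c.length ≤ r := by exact_mod_cast this
    omega
  obtain ⟨μ, hμL, hμ⟩ := hrank.exists_add_range_not_le H L hlen θ
  let Φ : (P' × Polynomial A) →ₗ[Polynomial A] Polynomial A :=
    (θ + μ).coprod (LinearMap.toSpanSingleton (Polynomial A) (Polynomial A) g)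
  have hΦ1 : Φ (0, 1) = g := by simp [Φ]
  have hdiff : ∀ x, Φ x - φ x ∈ L := by
    rintro ⟨v, a⟩
    have h1 : φ (v, a) = θ v + a * φ (0, 1) := by
      rw [← smul_eq_mul, ← map_smul]
      simp only [θ, LinearMap.comp_apply, LinearMap.inl_apply]
      rw [← map_add]; simp
    have h2 : Φ (v, a) - φ (v, a) = μ v + a * (Polynomial.X ^ N * f) := by
      rw [h1]; simp [Φ, g]; ring
    rw [h2]
    exact L.add_mem (hμL v) (L.mul_mem_left _ hXfL)
  refine ⟨Φ, ?_, hdiff, hΦ1 ▸ hg⟩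
  have hLI' : L ≤ I := hLI.trans (Ideal.pow_le_self two_ne_zero)
  let Q : Ideal (Polynomial A) := LinearMap.range Φ
  have hQI : Q ≤ I := by
    rintro _ ⟨x, rfl⟩
    have := I.add_mem (hLI' (hdiff x)) (hφI ⟨x, rfl⟩)
    simpa using this
  have hQL : I ≤ Q ⊔ L := by
    rw [← hφsurj]
    refine sup_le ?_ le_sup_right
    rintro _ ⟨x, rfl⟩
    have h1 : φ x = Φ x - (Φ x - φ x) := by ring
    rw [h1]
    exact Submodule.sub_mem _ (Submodule.mem_sup_left ⟨x, rfl⟩) (Submodule.mem_sup_right (hdiff x))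
  refine le_antisymm hQI (Ideal.le_of_le_sup_of_forall_isMaximal hLI hQL fun m hm hQm ↦ ?_)
  have hgm : g ∈ m := hQm ⟨(0, 1), hΦ1⟩
  have hmax : (m.comap Polynomial.C).IsMaximal := hg.isMaximal_comap_C m hgm
  have hHm : H ≤ m := by
    refine sup_le (Ideal.map_le_iff_le_comap.2 ?_) ((Ideal.span_singleton_le_iff_mem _).2 hgm)
    exact sInf_le ⟨bot_le, hmax⟩
  by_contra hLm
  obtain ⟨x, hx⟩ := hμ m hm.isPrime hHm hLm
  exact hx (hQm ⟨(x, 0), by simp [Φ]⟩)
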